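/- For every 0 ≤ s < 1, the squared cotangent quantum hitting time of Szegedy's quantum interpolated walk equals QHT(W(s), |init_ip⟩)² = 2·HT⁺(s) − (1/N)/(1 − s·(1 − 1/N)). -/

import Mathlib

open scoped BigOperators ComplexConjugate
open Complex

set_option linter.unusedSectionVars false

noncomputable section

namespace LQWPaper

variable {V : Type*} [Fintype V] [DecidableEq V]

/-- The inner product `⟨v,w⟩ = Σᵢ conj (v i) * w i` on `ι → ℂ`. -/
def cip {ι : Type*} [Fintype ι] (v w : ι → ℂ) : ℂ :=
  ∑ i, (starRingEnd ℂ) (v i) * w i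

/-- The `ℓ₂`-norm on `ι → ℂ`. -/
def l2norm {ι : Type*} [Fintype ι] (v : ι → ℂ) : ℝ :=
  Real.sqrt (∑ i, Complex.normSq (v i))

/-- The operator norm (with respect to the `ℓ₂`-norm) of a square matrix. -/
def opNorm {ι : Type*} [Fintype ι] (M : Matrix ι ι ℂ) : ℝ :=
  sSup {r : ℝ | ∃ v : ι → ℂ, l2norm v = 1 ∧ r = l2norm (M.mulVec v)}

/-- A fixed labeling `y_1(x), …, y_d(x)` of the `d` neighbors of each vertex of a
`d`-regular graph: a bijection from `Fin d` to the neighbor set of each vertex. -/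
structure Labeling (G : SimpleGraph V) (d : ℕ) where
  nbr : (x : V) → Fin d ≃ (G.neighborSet x)

lemma Labeling.adj {G : SimpleGraph V} {d : ℕ} (L : Labeling G d) (x : V) (i : Fin d) :
    G.Adj x (L.nbr x i) := (L.nbr x i).prop

/-- The (unique) index of `x` among the neighbors of `y`. -/
def Labeling.idx {G : SimpleGraph V} {d : ℕ} (L : Labeling G d) (y x : V)
    (h : G.Adj y x) : Fin d := (L.nbr y).symm ⟨x, h⟩

/-- The flip-flop shift on basis states: `|x, e_i⟩ ↦ |y, e_j⟩` where `y = y_i(x)` and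
`x = y_j(y)`, and `|x, ↻⟩ ↦ |x, ↻⟩`.  The self-loop is the coin index `Fin.last d`. -/
def shiftFun {G : SimpleGraph V} {d : ℕ} (L : Labeling G d)
    (p : V × Fin (d + 1)) : V × Fin (d + 1) :=
  if h : p.2 = Fin.last d then p
  else
    let i : Fin d := p.2.castPred h
    ⟨L.nbr p.1 i, Fin.castSucc (L.idx (L.nbr p.1 i) p.1 ((L.adj p.1 i).symm))⟩

/-- The flip-flop shift operator `S` as a matrix. -/
def shiftMat {G : SimpleGraph V} {d : ℕ} (L : Labeling G d) :
    Matrix (V × Fin (d + 1)) (V × Fin (d + 1)) ℂ :=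
  Matrix.of fun p q => if p = shiftFun L q then 1 else 0

/-- The coin state `|c⟩ = (1/√(d+ℓ)) (|e_1⟩ + ⋯ + |e_d⟩ + √ℓ |↻⟩)`. -/
def coinVec (d : ℕ) (ℓ : ℝ) : Fin (d + 1) → ℂ :=
  fun a => if a = Fin.last d then ((Real.sqrt ℓ / Real.sqrt (d + ℓ) : ℝ) : ℂ)
           else ((1 / Real.sqrt (d + ℓ) : ℝ) : ℂ)

/-- The coin operator `C = 2|c⟩⟨c| − I`. -/
def coinMat (d : ℕ) (ℓ : ℝ) : Matrix (Fin (d + 1)) (Fin (d + 1)) ℂ :=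
  (2 : ℂ) • Matrix.of (fun a b => coinVec d ℓ a * (starRingEnd ℂ) (coinVec d ℓ b)) - 1

/-- The global coin operator `I_N ⊗ C`. -/
def coinLift (d : ℕ) (ℓ : ℝ) :
    Matrix (V × Fin (d + 1)) (V × Fin (d + 1)) ℂ :=
  Matrix.of fun p q => if p.1 = q.1 then coinMat d ℓ p.2 q.2 else 0

/-- The oracle `G_or = (I_N − 2|m⟩⟨m|) ⊗ I_{d+1}`. -/
def oracleMat (d : ℕ) (m : V) : Matrix (V × Fin (d + 1)) (V × Fin (d + 1)) ℂ :=
  Matrix.of fun p q => if p = q then (if p.1 = m then -1 else 1) else 0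

/-- The lackadaisical quantum walk `U_lazy = S · (I_N ⊗ C) · G_or`. -/
def Ulazy {G : SimpleGraph V} {d : ℕ} (L : Labeling G d) (m : V) (ℓ : ℝ) :
    Matrix (V × Fin (d + 1)) (V × Fin (d + 1)) ℂ :=
  shiftMat L * coinLift d ℓ * oracleMat d m

/-- The initial state `|init_lazy⟩ = (1/√(N−1)) Σ_{x ≠ m} |x⟩ ⊗ |c⟩`. -/
def initLazy (m : V) (d : ℕ) (ℓ : ℝ) : V × Fin (d + 1) → ℂ :=
  fun p => if p.1 = m then 0
    else ((1 / Real.sqrt ((Fintype.card V : ℝ) - 1) : ℝ) : ℂ) * coinVec d ℓ p.2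

/-- The state `|⇒⟩ = (1/√d)(|e_1⟩ + ⋯ + |e_d⟩)`. -/
def plusVec (d : ℕ) : Fin (d + 1) → ℂ :=
  fun a => if a = Fin.last d then 0 else ((1 / Real.sqrt d : ℝ) : ℂ)

/-- The modified oracle `Ĝ_or = I − 2(|m,↻⟩⟨m,↻| + |m,⇒⟩⟨m,⇒|)`. -/
def oracleHat (d : ℕ) (m : V) : Matrix (V × Fin (d + 1)) (V × Fin (d + 1)) ℂ :=
  1 - (2 : ℂ) • Matrix.of (fun p q =>
    (if p = (m, Fin.last d) ∧ q = (m, Fin.last d) then 1 else 0)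
    + (if p.1 = m ∧ q.1 = m then plusVec d p.2 * (starRingEnd ℂ) (plusVec d q.2) else 0))

/-- The modified lackadaisical quantum walk `Û_lazy = S · (I_N ⊗ C) · Ĝ_or`. -/
def UlazyHat {G : SimpleGraph V} {d : ℕ} (L : Labeling G d) (m : V) (ℓ : ℝ) :
    Matrix (V × Fin (d + 1)) (V × Fin (d + 1)) ℂ :=
  shiftMat L * coinLift d ℓ * oracleHat d m

/-- The action of an automorphism `σ` of `G` on arcs and self-loops:
`P_σ |x, e_i⟩ = |σ x, e_j⟩` with `y_j(σ x) = σ (y_i x)`, and `P_σ |x, ↻⟩ = |σ x, ↻⟩`. -/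
def permFun {G : SimpleGraph V} {d : ℕ} (L : Labeling G d) (σ : G ≃g G)
    (p : V × Fin (d + 1)) : V × Fin (d + 1) :=
  if h : p.2 = Fin.last d then (σ p.1, p.2)
  else
    let i : Fin d := p.2.castPred h
    ⟨σ p.1, Fin.castSucc (L.idx (σ p.1) (σ (L.nbr p.1 i)) (σ.map_adj_iff.mpr (L.adj p.1 i)))⟩

/-- The unitary `P_σ` induced by an automorphism `σ` of `G`, as a matrix. -/
def permMat {G : SimpleGraph V} {d : ℕ} (L : Labeling G d) (σ : G ≃g G) :
    Matrix (V × Fin (d + 1)) (V × Fin (d + 1)) ℂ :=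
  Matrix.of fun p q => if p = permFun L σ q then 1 else 0

/-- `G` is locally arc-transitive if for any vertex `u` with neighbors `v₁, v₂` there is an
automorphism of `G` fixing `u` and mapping `v₁` to `v₂`. -/
def LocallyArcTransitive (G : SimpleGraph V) : Prop :=
  ∀ u v₁ v₂ : V, G.Adj u v₁ → G.Adj u v₂ → ∃ σ : G ≃g G, σ u = u ∧ σ v₁ = v₂

/-- The transition matrix `P` of the simple random walk on a `d`-regular graph. -/
def Pmat (G : SimpleGraph V) [DecidableRel G.Adj] (d : ℕ) : Matrix V V ℝ :=
  Matrix.of fun x y => if G.Adj x y then (1 : ℝ) / d else 0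

/-- The absorbing walk: row `m` is replaced by the unit vector at `m`. -/
def absorb (M : Matrix V V ℝ) (m : V) : Matrix V V ℝ :=
  Matrix.of fun x y => if x = m then (if y = m then 1 else 0) else M x y

/-- The interpolated walk `M(s) = (1−s) M + s M'`. -/
def interp (M : Matrix V V ℝ) (m : V) (s : ℝ) : Matrix V V ℝ :=
  (1 - s) • M + s • absorb M m

/-- The lazy random walk `P̂ = (d/(d+ℓ)) P + (ℓ/(d+ℓ)) I`. -/
def lazyP (G : SimpleGraph V) [DecidableRel G.Adj] (d : ℕ) (ℓ : ℝ) : Matrix V V ℝ :=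
  ((d : ℝ) / (d + ℓ)) • Pmat G d + (ℓ / (d + ℓ)) • (1 : Matrix V V ℝ)

/-- The submatrix `Q` of `P` obtained by deleting the row and column of `m`. -/
def Qsub (P : Matrix V V ℝ) (m : V) :
    Matrix {x : V // x ≠ m} {x : V // x ≠ m} ℝ :=
  Matrix.of fun x y => P x.1 y.1

/-- The hitting time `HT(P, {m}) = Σ_{t≥0} (1/N) Σ_{x≠m, y≠m} (Q^t)_{xy}`. -/
def hittingTime (P : Matrix V V ℝ) (m : V) : ℝ :=
  ∑' t : ℕ, (1 / (Fintype.card V : ℝ)) *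
    ∑ x : {x : V // x ≠ m}, ∑ y : {x : V // x ≠ m}, (Qsub P m ^ t) x y

/-- The state `|x⟩ ⊗ |P(s)_x⟩ = Σ_y √(P(s)_{xy}) |x,y⟩`. -/
def psVec (Ps : Matrix V V ℝ) (x : V) : V × V → ℂ :=
  fun p => if p.1 = x then ((Real.sqrt (Ps x p.2) : ℝ) : ℂ) else 0

/-- The projection `Π_A = Σ_x |x, P(s)_x⟩⟨x, P(s)_x|` onto `span{|x⟩ ⊗ |P(s)_x⟩}`. -/
def projA (Ps : Matrix V V ℝ) : Matrix (V × V) (V × V) ℂ :=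
  Matrix.of fun p q => ∑ x, psVec Ps x p * (starRingEnd ℂ) (psVec Ps x q)

/-- The swap of the two tensor factors of `ℂ^V ⊗ ℂ^V`, as a matrix. -/
def swapMat (V : Type*) [Fintype V] [DecidableEq V] : Matrix (V × V) (V × V) ℂ :=
  Matrix.of fun p q => if p.1 = q.2 ∧ p.2 = q.1 then 1 else 0

/-- Szegedy's quantum walk `W = SWAP · (2Π_A − I)` of a walk with matrix `Ps`. -/
def Wmat (Ps : Matrix V V ℝ) : Matrix (V × V) (V × V) ℂ :=
  swapMat V * ((2 : ℂ) • projA Ps - 1)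

/-- The initial state `|init_ip⟩ = (1/√(N−1)) Σ_{x ≠ m} |x⟩ ⊗ |P(s)_x⟩`. -/
def initIp (Ps : Matrix V V ℝ) (m : V) : V × V → ℂ :=
  fun p => if p.1 = m then 0
    else ((1 / Real.sqrt ((Fintype.card V : ℝ) - 1) : ℝ) : ℂ) * ((Real.sqrt (Ps p.1 p.2) : ℝ) : ℂ)

/-- The discriminant matrix, `D_{xy} = √(M_{xy} M_{yx})`. -/
def discr (M : Matrix V V ℝ) : Matrix V V ℝ :=
  Matrix.of fun x y => Real.sqrt (M x y * M y x)

/-- The unit vector `√π̄ = (1/√(N−1)) Σ_{x ≠ m} |x⟩`. -/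
def sqrtPiBar (m : V) : V → ℝ :=
  fun x => if x = m then 0 else 1 / Real.sqrt ((Fintype.card V : ℝ) - 1)

/-- `(θ, φ)` is an orthonormal eigenbasis of the (unitary) matrix `M`, with
eigenvalues `e^{iθ_k}` and eigenvectors `φ_k`. -/
def IsONEigenbasis {ι : Type*} [Fintype ι] [DecidableEq ι] (M : Matrix ι ι ℂ)
    (θ : ι → ℝ) (φ : ι → (ι → ℂ)) : Prop :=
  (∀ k l, cip (φ k) (φ l) = if k = l then 1 else 0) ∧
  (∀ k, M.mulVec (φ k) = Complex.exp ((θ k : ℂ) * Complex.I) • φ k)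

/-- The squared cotangent quantum hitting time
`QHT(U, w)² = Σ_{e^{iθ_k} ≠ 1} |⟨φ_k|w⟩|² cot²(θ_k/2)` computed in the
orthonormal eigenbasis `(θ, φ)`. -/
def QHTsq {ι : Type*} [Fintype ι] (θ : ι → ℝ) (φ : ι → (ι → ℂ)) (w : ι → ℂ) : ℝ :=
  ∑ k, if Complex.exp ((θ k : ℂ) * Complex.I) = 1 then 0
       else Complex.normSq (cip (φ k) w) * (Real.cos (θ k / 2) / Real.sin (θ k / 2)) ^ 2

/-- `(lam, v)` is a real orthonormal eigenbasis of the symmetric matrix `M`. -/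
def IsRealONEigenbasis (M : Matrix V V ℝ) (lam : V → ℝ) (v : V → (V → ℝ)) : Prop :=
  (∀ k l, (∑ x, v k x * v l x) = if k = l then 1 else 0) ∧
  (∀ k, M.mulVec (v k) = lam k • v k)

/-- The interpolated hitting time `HT⁺ = Σ_{λ_k ≠ 1} |⟨λ_k|√π̄⟩|² / (1 − λ_k)`,
computed in the orthonormal eigenbasis `(lam, v)` of the discriminant. -/
def HTplus (lam : V → ℝ) (v : V → (V → ℝ)) (m : V) : ℝ :=
  ∑ k, if lam k = 1 then 0 else (∑ x, v k x * sqrtPiBar m x) ^ 2 / (1 - lam k)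

/-- The map `E : ℂ^V ⊗ ℂ^V → ℂ^V ⊗ ℂ^{d+1}` with `E|x, y_i(x)⟩ = |x, e_i⟩`,
`E|x,x⟩ = |x,↻⟩` for `x ≠ m`, `E|m,m⟩ = −|m,↻⟩`, and `E|x,y⟩ = 0` otherwise. -/
def Emat {G : SimpleGraph V} [DecidableRel G.Adj] {d : ℕ}
    (L : Labeling G d) (m : V) : Matrix (V × Fin (d + 1)) (V × V) ℂ :=
  Matrix.of fun p q =>
    if h : G.Adj q.1 q.2 then
      (if p = (q.1, Fin.castSucc (L.idx q.1 q.2 h)) then 1 else 0)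
    else if q.2 = q.1 then
      (if p = (q.1, Fin.last d) then (if q.1 = m then -1 else 1) else 0)
    else 0

/-- `SWAP` applied to a vector of `ℂ^V ⊗ ℂ^V`. -/
def swapVecC (v : V × V → ℂ) : V × V → ℂ := fun p => v (p.2, p.1)

/-- The unit vector `|x, Ps_x^⊥⟩` orthogonal to `|x, Ps_x⟩` in
`span{|x, Ps_x⟩, SWAP |x, Ps_x⟩}` (Gram–Schmidt phase convention). -/
def perpVec (Ps : Matrix V V ℝ) (x : V) : V × V → ℂ :=
  fun p =>
    (swapVecC (psVec Ps x) - cip (psVec Ps x) (swapVecC (psVec Ps x)) • psVec Ps x) p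
      / ((l2norm (swapVecC (psVec Ps x) - cip (psVec Ps x) (swapVecC (psVec Ps x)) • psVec Ps x) : ℝ) : ℂ)

/-- The isometry `Σ_x (|x, Ps1_x⟩⟨x, Ps2_x| + |x, Ps1_x^⊥⟩⟨x, Ps2_x^⊥|)`;
`R₁ = Rmat P̂(s) P(s)` and `R₂ = Rmat P(s) P(s)`. -/
def Rmat (Ps1 Ps2 : Matrix V V ℝ) : Matrix (V × V) (V × V) ℂ :=
  Matrix.of fun p q => ∑ x, (psVec Ps1 x p * (starRingEnd ℂ) (psVec Ps2 x q)
    + perpVec Ps1 x p * (starRingEnd ℂ) (perpVec Ps2 x q))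

end LQWPaper

namespace LQWPaper

section Eigenbasis

variable {ι : Type*} [Fintype ι] [DecidableEq ι]

lemma cip_add_right (u x y : ι → ℂ) : cip u (x + y) = cip u x + cip u y := by
  simp [cip, mul_add, Finset.sum_add_distrib]

lemma cip_sub_right (u x y : ι → ℂ) : cip u (x - y) = cip u x - cip u y := by
  simp [cip, mul_sub, Finset.sum_sub_distrib]

lemma sum_mul_conj_of_orthonormal {φ : ι → ι → ℂ}
    (h : ∀ k l, cip (φ k) (φ l) = if k = l then 1 else 0) (i j : ι) :
    ∑ k, φ k i * (starRingEnd ℂ) (φ k j) = if i = j then 1 else 0 := by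
  let A : Matrix ι ι ℂ := Matrix.of fun k i => (starRingEnd ℂ) (φ k i)
  let B : Matrix ι ι ℂ := Matrix.of fun i k => φ k i
  have hAB : A * B = 1 := by
    ext k l
    simpa [A, B, Matrix.mul_apply, Matrix.one_apply, cip] using h k l
  have hBA : (B * A) i j = (1 : Matrix ι ι ℂ) i j := by rw [mul_eq_one_comm.mp hAB]
  simpa [A, B, Matrix.mul_apply, Matrix.one_apply] using hBA

lemma sum_cip_smul_of_orthonormal {φ : ι → ι → ℂ}
    (h : ∀ k l, cip (φ k) (φ l) = if k = l then 1 else 0) (u : ι → ℂ) :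
    ∑ k, cip (φ k) u • φ k = u := by
  ext i
  simp only [Finset.sum_apply, Pi.smul_apply, smul_eq_mul, cip, Finset.sum_mul]
  rw [Finset.sum_comm]
  calc _ = ∑ j, u j * ∑ k, φ k i * (starRingEnd ℂ) (φ k j) := by
        refine Finset.sum_congr rfl fun j _ => ?_
        rw [Finset.mul_sum]
        exact Finset.sum_congr rfl fun k _ => by ring
    _ = u i := by simp [sum_mul_conj_of_orthonormal h]

lemma sum_normSq_cip_of_orthonormal {φ : ι → ι → ℂ}
    (h : ∀ k l, cip (φ k) (φ l) = if k = l then 1 else 0) (u : ι → ℂ) :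
    ∑ k, Complex.normSq (cip (φ k) u) = ∑ i, Complex.normSq (u i) := by
  have hc : cip u u = ∑ k, (Complex.normSq (cip (φ k) u) : ℂ) := by
    calc cip u u = cip u (∑ k, cip (φ k) u • φ k) := by rw [sum_cip_smul_of_orthonormal h u]
      _ = ∑ k, cip (φ k) u * (starRingEnd ℂ) (cip (φ k) u) := by
        simp only [cip, Finset.sum_apply, Pi.smul_apply, smul_eq_mul, Finset.mul_sum, map_sum,
          map_mul, Complex.conj_conj]
        rw [Finset.sum_comm]
        refine Finset.sum_congr rfl fun k _ => Finset.sum_congr rfl fun i _ => ?_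
        rw [Finset.sum_mul, Finset.mul_sum, Finset.sum_mul]
        exact Finset.sum_congr rfl fun j _ => by ring
      _ = _ := by simp only [Complex.mul_conj]
  have hu : cip u u = ∑ i, (Complex.normSq (u i) : ℂ) := by
    simp only [cip, Complex.normSq_eq_conj_mul_self]
  exact_mod_cast hc.symm.trans hu

lemma IsONEigenbasis.cip_mulVec {M : Matrix ι ι ℂ} {θ : ι → ℝ} {φ : ι → ι → ℂ}
    (h : IsONEigenbasis M θ φ) (k : ι) (u : ι → ℂ) :
    cip (φ k) (M.mulVec u) = Complex.exp ((θ k : ℂ) * Complex.I) * cip (φ k) u := by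
  have hsum : ∀ f : ι → ι → ℂ, cip (φ k) (∑ l, f l) = ∑ l, cip (φ k) (f l) := fun f => by
    simp only [cip, Finset.sum_apply, Finset.mul_sum]
    exact Finset.sum_comm
  have hsmul : ∀ (c : ℂ) (f : ι → ℂ), cip (φ k) (c • f) = c * cip (φ k) f := fun c f => by
    simp only [cip, Pi.smul_apply, smul_eq_mul, Finset.mul_sum]
    exact Finset.sum_congr rfl fun i _ => by ring
  conv_lhs => rw [← sum_cip_smul_of_orthonormal h.1 u]
  simp only [Matrix.mulVec_sum, Matrix.mulVec_smul, h.2, hsum, hsmul, h.1]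
  simp [mul_comm]

lemma normSq_exp_mul_I_sub_one (t : ℝ) :
    Complex.normSq (Complex.exp ((t : ℂ) * Complex.I) - 1) = 4 * Real.sin (t / 2) ^ 2 := by
  have h2 : t = 2 * (t / 2) := by ring
  rw [Complex.normSq_apply]
  simp only [Complex.sub_re, Complex.sub_im, Complex.exp_ofReal_mul_I_re,
    Complex.exp_ofReal_mul_I_im, Complex.one_re, Complex.one_im]
  rw [h2, Real.cos_two_mul, Real.sin_two_mul, ← h2]
  linear_combination 4 * Real.cos (t / 2) ^ 2 * Real.sin_sq_add_cos_sq (t / 2)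
    - 4 * Real.sin_sq_add_cos_sq (t / 2)

lemma normSq_exp_mul_I_add_one (t : ℝ) :
    Complex.normSq (Complex.exp ((t : ℂ) * Complex.I) + 1) = 4 * Real.cos (t / 2) ^ 2 := by
  have h2 : t = 2 * (t / 2) := by ring
  rw [Complex.normSq_apply]
  simp only [Complex.add_re, Complex.add_im, Complex.exp_ofReal_mul_I_re,
    Complex.exp_ofReal_mul_I_im, Complex.one_re, Complex.one_im]
  rw [h2, Real.cos_two_mul, Real.sin_two_mul, ← h2]
  linear_combination 4 * Real.cos (t / 2) ^ 2 * Real.sin_sq_add_cos_sq (t / 2)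

/-- If `w` differs from `w₀` by a vector fixed by `M`, and `u` solves
`(M - 1) u = (M + 1) w₀` with `u + w₀` in the range of `1 - M`, then `QHTsq` is `‖u‖²`. -/
lemma IsONEigenbasis.QHTsq_eq_sum_normSq {M : Matrix ι ι ℂ} {θ : ι → ℝ} {φ : ι → ι → ℂ}
    (h : IsONEigenbasis M θ φ) {w₀ w₁ q u : ι → ℂ} (hw₁ : M.mulVec w₁ = w₁)
    (hu : u = q - M.mulVec q - w₀) (hMu : M.mulVec u - u = M.mulVec w₀ + w₀) :
    QHTsq θ φ (w₀ + w₁) = ∑ i, Complex.normSq (u i) := by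
  rw [← sum_normSq_cip_of_orthonormal h.1 u, QHTsq]
  refine Finset.sum_congr rfl fun k _ => ?_
  have h₁ := h.cip_mulVec k w₁
  have h₂ := congrArg (cip (φ k)) hMu
  rw [hw₁] at h₁
  rw [cip_sub_right, cip_add_right, h.cip_mulVec, h.cip_mulVec] at h₂
  split_ifs with he
  · have h₃ := congrArg (cip (φ k)) hu
    rw [cip_sub_right, cip_sub_right, h.cip_mulVec] at h₃
    rw [he] at h₂ h₃
    have : cip (φ k) u = 0 := by linear_combination h₃ + h₂ / 2
    simp [this]
  · have hne : Complex.exp ((θ k : ℂ) * Complex.I) - 1 ≠ 0 := sub_ne_zero.mpr he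
    have hz : cip (φ k) w₁ = 0 := by
      have : (Complex.exp ((θ k : ℂ) * Complex.I) - 1) * cip (φ k) w₁ = 0 := by
        linear_combination -h₁
      exact (mul_eq_zero.mp this).resolve_left hne
    have h₄ : (Complex.exp ((θ k : ℂ) * Complex.I) - 1) * cip (φ k) u =
        (Complex.exp ((θ k : ℂ) * Complex.I) + 1) * cip (φ k) w₀ := by
      linear_combination h₂
    have h₅ := congrArg Complex.normSq h₄
    rw [Complex.normSq_mul, Complex.normSq_mul, normSq_exp_mul_I_sub_one,
      normSq_exp_mul_I_add_one] at h₅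
    have hs : Real.sin (θ k / 2) ≠ 0 := fun h0 => by
      have := normSq_exp_mul_I_sub_one (θ k)
      rw [h0] at this
      exact hne (Complex.normSq_eq_zero.mp (by simpa using this))
    rw [cip_add_right, hz, add_zero]
    field_simp
    linarith

end Eigenbasis

section Discriminant

variable {V : Type*} [Fintype V] [DecidableEq V]

lemma IsRealONEigenbasis.sum_dotProduct_smul {M : Matrix V V ℝ} {lam : V → ℝ} {v : V → V → ℝ}
    (h : IsRealONEigenbasis M lam v) (x : V → ℝ) : ∑ k, (v k ⬝ᵥ x) • v k = x := by
  let A : Matrix V V ℝ := Matrix.of v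
  have hA : A * A.transpose = 1 := by
    ext k l
    simpa [A, Matrix.mul_apply, Matrix.one_apply] using h.1 k l
  have hB := mul_eq_one_comm.mp hA
  calc ∑ k, (v k ⬝ᵥ x) • v k = A.transpose.mulVec (A.mulVec x) := by
        ext i
        simp [A, Matrix.mulVec, dotProduct, mul_comm]
    _ = x := by rw [Matrix.mulVec_mulVec, hB, Matrix.one_mulVec]

lemma IsRealONEigenbasis.sum_dotProduct_sq {M : Matrix V V ℝ} {lam : V → ℝ} {v : V → V → ℝ}
    (h : IsRealONEigenbasis M lam v) (x : V → ℝ) : ∑ k, (v k ⬝ᵥ x) ^ 2 = x ⬝ᵥ x := by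
  conv_rhs => rw [← h.sum_dotProduct_smul x]
  simp only [sum_dotProduct, smul_dotProduct, smul_eq_mul]
  rw [h.sum_dotProduct_smul x]
  exact Finset.sum_congr rfl fun k _ => sq _

lemma IsRealONEigenbasis.dotProduct_sum_smul {M : Matrix V V ℝ} {lam : V → ℝ} {v : V → V → ℝ}
    (h : IsRealONEigenbasis M lam v) (k : V) (a : V → ℝ) : v k ⬝ᵥ (∑ l, a l • v l) = a k := by
  have h1 : ∀ l, v k ⬝ᵥ v l = if k = l then 1 else 0 := h.1 k
  simp [dotProduct_sum, h1]

lemma IsRealONEigenbasis.dotProduct_mulVec {M : Matrix V V ℝ} {lam : V → ℝ} {v : V → V → ℝ}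
    (h : IsRealONEigenbasis M lam v) (k : V) (x : V → ℝ) :
    v k ⬝ᵥ M.mulVec x = lam k * (v k ⬝ᵥ x) := by
  conv_lhs => rw [← h.sum_dotProduct_smul x]
  simp only [Matrix.mulVec_sum, Matrix.mulVec_smul, h.2, smul_smul]
  rw [h.dotProduct_sum_smul, mul_comm]

/-- A solution `g` of `(1 - D) g = w₀`, where `w₀` is the part of `w` orthogonal to the
`1`-eigenspace, and the value of `‖g‖² - ‖D g‖²`. -/
lemma IsRealONEigenbasis.exists_sub_mulVec_eq {M : Matrix V V ℝ} {lam : V → ℝ} {v : V → V → ℝ}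
    (h : IsRealONEigenbasis M lam v) {w w₀ : V → ℝ} (h₁ : ∀ k, lam k = 1 → v k ⬝ᵥ w₀ = 0)
    (hne : ∀ k, lam k ≠ 1 → v k ⬝ᵥ w₀ = v k ⬝ᵥ w) :
    ∃ g, g - M.mulVec g = w₀ ∧
      g ⬝ᵥ g - M.mulVec g ⬝ᵥ M.mulVec g =
        2 * (∑ k, if lam k = 1 then 0 else (v k ⬝ᵥ w) ^ 2 / (1 - lam k)) - w₀ ⬝ᵥ w₀ := by
  let g := ∑ k, ((v k ⬝ᵥ w₀) / (1 - lam k)) • v k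
  have hg : ∀ k, v k ⬝ᵥ g = (v k ⬝ᵥ w₀) / (1 - lam k) := fun k => h.dotProduct_sum_smul k _
  refine ⟨g, ?_, ?_⟩
  · rw [← h.sum_dotProduct_smul (g - M.mulVec g)]
    conv_rhs => rw [← h.sum_dotProduct_smul w₀]
    refine Finset.sum_congr rfl fun k _ => ?_
    congr 1
    rw [dotProduct_sub, h.dotProduct_mulVec, hg]
    by_cases hk : lam k = 1
    · simp [h₁ k hk]
    · have : 1 - lam k ≠ 0 := sub_ne_zero.mpr (Ne.symm hk)
      field_simp
  · rw [← h.sum_dotProduct_sq g, ← h.sum_dotProduct_sq (M.mulVec g), ← h.sum_dotProduct_sq w₀,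
      Finset.mul_sum, ← Finset.sum_sub_distrib, ← Finset.sum_sub_distrib]
    refine Finset.sum_congr rfl fun k _ => ?_
    rw [h.dotProduct_mulVec, hg]
    split_ifs with hk
    · simp [h₁ k hk]
    · have : 1 - lam k ≠ 0 := sub_ne_zero.mpr (Ne.symm hk)
      rw [hne k hk]
      field_simp
      ring

/-- The isometry `|x⟩ ↦ |x⟩ ⊗ |Ps_x⟩`. -/
def edgeLift (Ps : Matrix V V ℝ) (x : V → ℝ) : V × V → ℂ :=
  fun p => ((x p.1 * √(Ps p.1 p.2) : ℝ) : ℂ)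

lemma edgeLift_add (Ps : Matrix V V ℝ) (x y : V → ℝ) :
    edgeLift Ps (x + y) = edgeLift Ps x + edgeLift Ps y := by
  ext p; simp [edgeLift, add_mul]

lemma edgeLift_sub (Ps : Matrix V V ℝ) (x y : V → ℝ) :
    edgeLift Ps (x - y) = edgeLift Ps x - edgeLift Ps y := by
  ext p; simp [edgeLift, sub_mul]

lemma projA_mulVec (Ps : Matrix V V ℝ) (f : V × V → ℂ) (p : V × V) :
    (projA Ps).mulVec f p = (√(Ps p.1 p.2) : ℂ) * ∑ y, (√(Ps p.1 y) : ℂ) * f (p.1, y) := by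
  simp only [projA, psVec, Matrix.mulVec, dotProduct, Matrix.of_apply, Fintype.sum_prod_type,
    apply_ite (starRingEnd ℂ), map_zero, Complex.conj_ofReal, ite_mul, zero_mul, mul_ite, mul_zero]
  simp [Finset.mul_sum, mul_assoc]

lemma Wmat_mulVec (Ps : Matrix V V ℝ) (f : V × V → ℂ) :
    (Wmat Ps).mulVec f = swapVecC ((2 : ℂ) • (projA Ps).mulVec f - f) := by
  have hswap : ∀ f : V × V → ℂ, (swapMat V).mulVec f = swapVecC f := fun f => by
    ext ⟨a, b⟩
    simp [swapMat, swapVecC, Matrix.mulVec, dotProduct, Fintype.sum_prod_type, ite_and]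
  rw [Wmat, ← Matrix.mulVec_mulVec, hswap, Matrix.sub_mulVec, Matrix.smul_mulVec,
    Matrix.one_mulVec]

lemma projA_mulVec_edgeLift {Ps : Matrix V V ℝ} (h0 : ∀ x y, 0 ≤ Ps x y)
    (h1 : ∀ x, ∑ y, Ps x y = 1) (x : V → ℝ) :
    (projA Ps).mulVec (edgeLift Ps x) = edgeLift Ps x := by
  ext ⟨a, b⟩
  rw [projA_mulVec]
  simp only [edgeLift]
  norm_cast
  have : ∀ y, √(Ps a y) * (x a * √(Ps a y)) = x a * Ps a y := fun y => by
    linear_combination x a * Real.mul_self_sqrt (h0 a y)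
  simp only [this, ← Finset.mul_sum, h1, mul_one]
  exact mul_comm _ _

lemma projA_mulVec_swapVecC_edgeLift {Ps : Matrix V V ℝ} (h0 : ∀ x y, 0 ≤ Ps x y) (x : V → ℝ) :
    (projA Ps).mulVec (swapVecC (edgeLift Ps x)) = edgeLift Ps ((discr Ps).mulVec x) := by
  ext ⟨a, b⟩
  rw [projA_mulVec]
  simp only [edgeLift, swapVecC, discr, Matrix.mulVec, dotProduct, Matrix.of_apply]
  norm_cast
  rw [mul_comm]
  congr 1
  refine Finset.sum_congr rfl fun y _ => ?_
  rw [Real.sqrt_mul (h0 a y)]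
  ring

lemma Wmat_mulVec_edgeLift {Ps : Matrix V V ℝ} (h0 : ∀ x y, 0 ≤ Ps x y)
    (h1 : ∀ x, ∑ y, Ps x y = 1) (x : V → ℝ) :
    (Wmat Ps).mulVec (edgeLift Ps x) = swapVecC (edgeLift Ps x) := by
  rw [Wmat_mulVec, projA_mulVec_edgeLift h0 h1]
  congr 1
  module

lemma Wmat_mulVec_swapVecC_edgeLift {Ps : Matrix V V ℝ} (h0 : ∀ x y, 0 ≤ Ps x y) (x : V → ℝ) :
    (Wmat Ps).mulVec (swapVecC (edgeLift Ps x)) =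
      (2 : ℂ) • swapVecC (edgeLift Ps ((discr Ps).mulVec x)) - edgeLift Ps x := by
  rw [Wmat_mulVec, projA_mulVec_swapVecC_edgeLift h0]
  rfl

lemma sum_normSq_edgeLift_sub_swapVecC {Ps : Matrix V V ℝ} (h0 : ∀ x y, 0 ≤ Ps x y)
    (h1 : ∀ x, ∑ y, Ps x y = 1) (x y : V → ℝ) :
    ∑ p, Complex.normSq ((edgeLift Ps x - swapVecC (edgeLift Ps y)) p) =
      x ⬝ᵥ x + y ⬝ᵥ y - 2 * (x ⬝ᵥ (discr Ps).mulVec y) := by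
  have hp : ∀ a b, Complex.normSq ((edgeLift Ps x - swapVecC (edgeLift Ps y)) (a, b)) =
      x a * x a * Ps a b + y b * y b * Ps b a - 2 * (x a * (√(Ps a b * Ps b a) * y b)) := by
    intro a b
    simp only [edgeLift, swapVecC, Pi.sub_apply]
    rw [← Complex.ofReal_sub, Complex.normSq_ofReal, Real.sqrt_mul (h0 a b)]
    linear_combination x a * x a * Real.mul_self_sqrt (h0 a b)
      + y b * y b * Real.mul_self_sqrt (h0 b a)
  rw [Fintype.sum_prod_type]
  simp only [hp, Finset.sum_sub_distrib, Finset.sum_add_distrib, ← Finset.mul_sum, h1]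
  rw [Finset.sum_comm (f := fun a b => y b * y b * Ps b a)]
  simp [← Finset.mul_sum, h1, dotProduct, Matrix.mulVec, discr]

lemma swapVecC_edgeLift_of_reversible {Ps : Matrix V V ℝ} {r : V → ℝ} (hr : ∀ x, 0 ≤ r x)
    (hbal : ∀ x y, r x ^ 2 * Ps x y = r y ^ 2 * Ps y x) :
    swapVecC (edgeLift Ps r) = edgeLift Ps r := by
  ext ⟨a, b⟩
  simp only [swapVecC, edgeLift]
  congr 1
  have := congrArg Real.sqrt (hbal b a)
  rwa [Real.sqrt_mul (sq_nonneg _), Real.sqrt_mul (sq_nonneg _), Real.sqrt_sq (hr _),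
    Real.sqrt_sq (hr _)] at this

lemma discr_mul_of_reversible {Ps : Matrix V V ℝ} (h0 : ∀ x y, 0 ≤ Ps x y) {r : V → ℝ}
    (hr : ∀ x, 0 ≤ r x) (hbal : ∀ x y, r x ^ 2 * Ps x y = r y ^ 2 * Ps y x) (x y : V) :
    discr Ps x y * r y = Ps x y * r x := by
  have h : Ps x y * Ps y x * r y ^ 2 = (Ps x y * r x) ^ 2 := by
    linear_combination -Ps x y * hbal x y
  calc discr Ps x y * r y = √(Ps x y * Ps y x) * √(r y ^ 2) := by
        rw [Real.sqrt_sq (hr y)]; rfl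
    _ = Ps x y * r x := by
        rw [← Real.sqrt_mul (mul_nonneg (h0 x y) (h0 y x)), h,
          Real.sqrt_sq (mul_nonneg (h0 x y) (hr x))]

lemma discr_comm (Ps : Matrix V V ℝ) (x y : V) : discr Ps x y = discr Ps y x := by
  simp [discr, mul_comm]

/-- A `1`-eigenvector of the discriminant of a reversible walk is proportional to `√π` along
every transition of positive probability. -/
lemma mul_eq_mul_of_discr_mulVec_eq {Ps : Matrix V V ℝ} (h0 : ∀ x y, 0 ≤ Ps x y)
    (h1 : ∀ x, ∑ y, Ps x y = 1) {r : V → ℝ} (hr : ∀ x, 0 < r x)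
    (hbal : ∀ x y, r x ^ 2 * Ps x y = r y ^ 2 * Ps y x) {f : V → ℝ}
    (hf : (discr Ps).mulVec f = f) {x y : V} (hxy : 0 < Ps x y) (hyx : 0 < Ps y x) :
    f x / r x = f y / r y := by
  have hD := discr_mul_of_reversible h0 (fun x => (hr x).le) hbal
  have hDnn : ∀ a b, 0 ≤ discr Ps a b := fun a b => Real.sqrt_nonneg _
  have hterm : ∀ a b, discr Ps a b * r a * r b * (f a / r a - f b / r b) ^ 2 =
      f a * f a * Ps a b + f b * f b * Ps b a - 2 * (f a * (discr Ps a b * f b)) := by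
    intro a b
    have ha := (hr a).ne'
    have hb := (hr b).ne'
    have e1 := hD a b
    have e2 := hD b a
    rw [discr_comm] at e2
    field_simp
    linear_combination f a ^ 2 * r b * e1 + f b ^ 2 * r a * e2
  have hsum : ∑ a, ∑ b, discr Ps a b * r a * r b * (f a / r a - f b / r b) ^ 2 = 0 := by
    simp only [hterm, Finset.sum_sub_distrib, Finset.sum_add_distrib, ← Finset.mul_sum, h1]
    rw [Finset.sum_comm (f := fun a b => f b * f b * Ps b a)]
    have : ∀ a, ∑ b, discr Ps a b * f b = f a := fun a => congrFun hf a
    simp only [← Finset.mul_sum, h1, this, mul_one]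
    ring
  have hnn : ∀ a b, 0 ≤ discr Ps a b * r a * r b * (f a / r a - f b / r b) ^ 2 := fun a b =>
    mul_nonneg (mul_nonneg (mul_nonneg (hDnn a b) (hr a).le) (hr b).le) (sq_nonneg _)
  have hz := (Finset.sum_eq_zero_iff_of_nonneg fun a _ => Finset.sum_nonneg fun b _ => hnn a b).mp
    hsum x (Finset.mem_univ x)
  have hz' := (Finset.sum_eq_zero_iff_of_nonneg fun b _ => hnn x b).mp hz y (Finset.mem_univ y)
  have hDpos : 0 < discr Ps x y := Real.sqrt_pos.mpr (mul_pos hxy hyx)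
  have hpos := mul_pos (mul_pos hDpos (hr x)) (hr y)
  exact sub_eq_zero.mp (pow_eq_zero_iff two_ne_zero |>.mp
    ((mul_eq_zero.mp hz').resolve_left hpos.ne'))

end Discriminant

section Interpolated

variable {V : Type*} [Fintype V] [DecidableEq V]

/-- The square root of the (unnormalised) stationary weight of the interpolated walk. -/
def sqrtStat (m : V) (s : ℝ) : V → ℝ := fun x => if x = m then 1 else √(1 - s)

lemma interp_Pmat_apply (G : SimpleGraph V) [DecidableRel G.Adj] (d : ℕ) (m : V) (s : ℝ)
    (x y : V) : interp (Pmat G d) m s x y =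
      if x = m then (1 - s) * Pmat G d x y + s * (if y = m then 1 else 0) else Pmat G d x y := by
  simp only [interp, absorb, Matrix.add_apply, Matrix.smul_apply, Matrix.of_apply, smul_eq_mul]
  split_ifs <;> ring

lemma Pmat_nonneg (G : SimpleGraph V) [DecidableRel G.Adj] (d : ℕ) (x y : V) :
    0 ≤ Pmat G d x y := by
  rw [Pmat, Matrix.of_apply]; split_ifs <;> positivity

lemma sum_Pmat {G : SimpleGraph V} [DecidableRel G.Adj] {d : ℕ} (hd : 1 ≤ d)
    (hreg : G.IsRegularOfDegree d) (x : V) : ∑ y, Pmat G d x y = 1 := by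
  have h : (d : ℝ) ≠ 0 := by positivity
  have hc : (Finset.univ.filter fun y => G.Adj x y).card = d := by
    rw [← hreg x, ← G.card_neighborFinset_eq_degree, G.neighborFinset_eq_filter]
  simp only [Pmat, Matrix.of_apply, ← Finset.sum_filter, Finset.sum_const, hc, nsmul_eq_mul]
  field_simp

lemma interp_Pmat_nonneg (G : SimpleGraph V) [DecidableRel G.Adj] (d : ℕ) (m : V) {s : ℝ}
    (hs0 : 0 ≤ s) (hs1 : s ≤ 1) (x y : V) : 0 ≤ interp (Pmat G d) m s x y := by
  have := Pmat_nonneg G d x y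
  have h1 : 0 ≤ 1 - s := sub_nonneg.mpr hs1
  rw [interp_Pmat_apply]
  split_ifs <;> positivity

lemma sum_interp_Pmat {G : SimpleGraph V} [DecidableRel G.Adj] {d : ℕ} (hd : 1 ≤ d)
    (hreg : G.IsRegularOfDegree d) (m : V) (s : ℝ) (x : V) :
    ∑ y, interp (Pmat G d) m s x y = 1 := by
  have h := sum_Pmat hd hreg
  simp only [interp_Pmat_apply]
  split_ifs with hx
  · rw [Finset.sum_add_distrib, ← Finset.mul_sum, ← Finset.mul_sum, h]
    simp
  · exact h x

lemma interp_Pmat_pos {G : SimpleGraph V} [DecidableRel G.Adj] {d : ℕ} (hd : 1 ≤ d) (m : V)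
    {s : ℝ} (hs0 : 0 ≤ s) (hs1 : s < 1) {x y : V} (hxy : G.Adj x y) :
    0 < interp (Pmat G d) m s x y := by
  have h : 0 < (d : ℝ) := by positivity
  have h1 : 0 < 1 - s := sub_pos.mpr hs1
  rw [interp_Pmat_apply, Pmat, Matrix.of_apply, if_pos hxy]
  split_ifs <;> positivity

lemma sqrtStat_pos (m : V) {s : ℝ} (hs1 : s < 1) (x : V) : 0 < sqrtStat m s x := by
  have h1 : 0 < 1 - s := sub_pos.mpr hs1
  unfold sqrtStat
  split_ifs <;> positivity

lemma sqrtStat_reversible (G : SimpleGraph V) [DecidableRel G.Adj] (d : ℕ) (m : V) {s : ℝ}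
    (hs1 : s ≤ 1) (x y : V) :
    sqrtStat m s x ^ 2 * interp (Pmat G d) m s x y =
      sqrtStat m s y ^ 2 * interp (Pmat G d) m s y x := by
  have hsq := Real.sq_sqrt (sub_nonneg.mpr hs1)
  have hsymm : Pmat G d x y = Pmat G d y x := by simp [Pmat, G.adj_comm]
  rw [interp_Pmat_apply, interp_Pmat_apply, hsymm]
  unfold sqrtStat
  split_ifs with hx hy hy
  · rfl
  · rw [hsq]; ring
  · rw [hsq]; ring
  · rfl

lemma exists_smul_sqrtStat {G : SimpleGraph V} [DecidableRel G.Adj] {d : ℕ} (hd : 1 ≤ d)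
    (hreg : G.IsRegularOfDegree d) (hconn : G.Connected) (m : V) {s : ℝ} (hs0 : 0 ≤ s)
    (hs1 : s < 1) {f : V → ℝ} (hf : (discr (interp (Pmat G d) m s)).mulVec f = f) :
    ∃ c : ℝ, f = c • sqrtStat m s := by
  have hr := sqrtStat_pos m hs1
  have hadj : ∀ x y, G.Adj x y → f x / sqrtStat m s x = f y / sqrtStat m s y := fun x y h =>
    mul_eq_mul_of_discr_mulVec_eq (interp_Pmat_nonneg G d m hs0 hs1.le)
      (sum_interp_Pmat hd hreg m s) hr (sqrtStat_reversible G d m hs1.le) hf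
      (interp_Pmat_pos hd m hs0 hs1 h) (interp_Pmat_pos hd m hs0 hs1 h.symm)
  have hwalk : ∀ x y, G.Walk x y → f x / sqrtStat m s x = f y / sqrtStat m s y := by
    intro x y p
    induction p with
    | nil => rfl
    | cons h _ ih => exact (hadj _ _ h).trans ih
  refine ⟨f m / sqrtStat m s m, funext fun x => ?_⟩
  obtain ⟨p⟩ := hconn.preconnected x m
  rw [Pi.smul_apply, smul_eq_mul, ← hwalk x m p, div_mul_cancel₀ _ (hr x).ne']

lemma sum_ite_eq_const (m : V) (a b : ℝ) :
    ∑ x : V, (if x = m then a else b) = a + ((Fintype.card V : ℝ) - 1) * b := by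
  have : ∀ x : V, (if x = m then a else b) = (if x = m then a - b else 0) + b := fun x => by
    split_ifs <;> ring
  simp only [this, Finset.sum_add_distrib]
  simp
  ring

lemma sqrtStat_dotProduct_self (m : V) {s : ℝ} (hs1 : s ≤ 1) :
    sqrtStat m s ⬝ᵥ sqrtStat m s = 1 + ((Fintype.card V : ℝ) - 1) * (1 - s) := by
  rw [← sum_ite_eq_const m]
  refine Finset.sum_congr rfl fun x _ => ?_
  unfold sqrtStat
  split_ifs
  · ring
  · exact Real.mul_self_sqrt (sub_nonneg.mpr hs1)

lemma sqrtPiBar_dotProduct_self (m : V) (hN : 1 < Fintype.card V) :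
    sqrtPiBar m ⬝ᵥ sqrtPiBar m = 1 := by
  have h : 0 < (Fintype.card V : ℝ) - 1 := sub_pos.mpr (by exact_mod_cast hN)
  calc _ = ∑ x : V, (if x = m then 0 else 1 / ((Fintype.card V : ℝ) - 1)) := by
        refine Finset.sum_congr rfl fun x _ => ?_
        unfold sqrtPiBar
        split_ifs
        · ring
        · rw [div_mul_div_comm, Real.mul_self_sqrt h.le, one_mul]
    _ = 1 := by rw [sum_ite_eq_const]; field_simp; ring

lemma sqrtStat_dotProduct_sqrtPiBar (m : V) (hN : 1 < Fintype.card V) (s : ℝ) :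
    sqrtStat m s ⬝ᵥ sqrtPiBar m = √((Fintype.card V : ℝ) - 1) * √(1 - s) := by
  have h : 0 < (Fintype.card V : ℝ) - 1 := sub_pos.mpr (by exact_mod_cast hN)
  calc _ = ∑ x : V, (if x = m then 0 else √(1 - s) / √((Fintype.card V : ℝ) - 1)) := by
        refine Finset.sum_congr rfl fun x _ => ?_
        unfold sqrtPiBar sqrtStat
        split_ifs <;> ring
    _ = _ := by
        rw [sum_ite_eq_const]
        have h' := (Real.sqrt_pos.mpr h).ne'
        field_simp
        rw [Real.sq_sqrt h.le]
        ring

lemma initIp_eq_edgeLift (Ps : Matrix V V ℝ) (m : V) :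
    initIp Ps m = edgeLift Ps (sqrtPiBar m) := by
  ext p
  simp only [initIp, edgeLift, sqrtPiBar]
  split_ifs <;> simp

end Interpolated

theorem statement_9 {V : Type*} [Fintype V] [DecidableEq V]
    (G : SimpleGraph V) [DecidableRel G.Adj] (d : ℕ) (m : V)
    (hd : 1 ≤ d) (hN : 3 ≤ Fintype.card V) (hconn : G.Connected)
    (hreg : G.IsRegularOfDegree d)
    (N s : ℝ) (hNdef : N = Fintype.card V) (hs0 : 0 ≤ s) (hs1 : s < 1)
    (θ' : V × V → ℝ) (φ' : V × V → (V × V → ℂ))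
    (hφ' : IsONEigenbasis (Wmat (interp (Pmat G d) m s)) θ' φ')
    (lam : V → ℝ) (v : V → (V → ℝ))
    (hlv : IsRealONEigenbasis (discr (interp (Pmat G d) m s)) lam v) :
    QHTsq θ' φ' (initIp (interp (Pmat G d) m s) m) =
      2 * HTplus lam v m - (1 / N) / (1 - s * (1 - 1 / N)) := by
  have hcard : 1 < Fintype.card V := by omega
  have h0 := interp_Pmat_nonneg G d m hs0 hs1.le
  have h1 := sum_interp_Pmat hd hreg m s
  have hr := fun x => (sqrtStat_pos m hs1 x).le
  have hbal := sqrtStat_reversible G d m hs1.le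
  have hfix : ∀ {f}, (discr (interp (Pmat G d) m s)).mulVec f = f → ∃ c : ℝ, f = c • sqrtStat m s :=
    exists_smul_sqrtStat hd hreg hconn m hs0 hs1
  have hr1 : (discr (interp (Pmat G d) m s)).mulVec (sqrtStat m s) = sqrtStat m s := by
    ext x
    simp only [Matrix.mulVec, dotProduct, discr_mul_of_reversible h0 hr hbal, ← Finset.sum_mul,
      h1, one_mul]
  have hrr := sqrtStat_dotProduct_self m hs1.le
  have hrw := sqrtStat_dotProduct_sqrtPiBar m hcard s
  have hww := sqrtPiBar_dotProduct_self m hcard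
  have hn : 0 < (Fintype.card V : ℝ) - 1 := sub_pos.mpr (by exact_mod_cast hcard)
  have hs : 0 < 1 - s := sub_pos.mpr hs1
  have hrr0 : sqrtStat m s ⬝ᵥ sqrtStat m s ≠ 0 := by rw [hrr]; positivity
  generalize interp (Pmat G d) m s = Ps at *
  generalize sqrtStat m s = r at *
  rw [initIp_eq_edgeLift]
  unfold HTplus
  change _ = 2 * (∑ k, if lam k = 1 then 0 else (v k ⬝ᵥ sqrtPiBar m) ^ 2 / (1 - lam k)) - _
  generalize sqrtPiBar m = w at *
  obtain ⟨c, hc⟩ : ∃ c, c = (r ⬝ᵥ w) / (r ⬝ᵥ r) := ⟨_, rfl⟩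
  obtain ⟨w₀, hw₀⟩ : ∃ w₀, w₀ = w - c • r := ⟨_, rfl⟩
  obtain ⟨g, hg, hnorm⟩ := hlv.exists_sub_mulVec_eq (w := w) (w₀ := w₀)
    (fun k hk => by
      obtain ⟨a, ha⟩ := hfix (f := v k) (by rw [hlv.2, hk, one_smul])
      rw [ha, hw₀, smul_dotProduct, dotProduct_sub, dotProduct_smul, hc, smul_eq_mul,
        smul_eq_mul, div_mul_cancel₀ _ hrr0, sub_self, mul_zero])
    (fun k hk => by
      have := hlv.dotProduct_mulVec k r
      rw [hr1] at this
      have h2 : (1 - lam k) * (v k ⬝ᵥ r) = 0 := by linear_combination this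
      have h3 := (mul_eq_zero.mp h2).resolve_left (sub_ne_zero.mpr (Ne.symm hk))
      rw [hw₀, dotProduct_sub, dotProduct_smul, h3, smul_zero, sub_zero])
  have hw : edgeLift Ps w = edgeLift Ps w₀ + edgeLift Ps (c • r) := by
    rw [← edgeLift_add, hw₀, sub_add_cancel]
  have hfixr : (Wmat Ps).mulVec (edgeLift Ps (c • r)) = edgeLift Ps (c • r) := by
    rw [Wmat_mulVec_edgeLift h0 h1]
    have := swapVecC_edgeLift_of_reversible hr hbal
    ext p
    have hp := congrFun this p
    simp only [swapVecC, edgeLift, Pi.smul_apply, smul_eq_mul, mul_assoc] at hp ⊢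
    rw [Complex.ofReal_mul, hp, ← Complex.ofReal_mul]
  rw [hw, hφ'.QHTsq_eq_sum_normSq (q := edgeLift Ps g)
      (u := edgeLift Ps ((discr Ps).mulVec g) - swapVecC (edgeLift Ps g)) hfixr,
    sum_normSq_edgeLift_sub_swapVecC h0 h1]
  · have hw₀w₀ : w₀ ⬝ᵥ w₀ = (1 / N) / (1 - s * (1 - 1 / N)) := by
      have e : w₀ ⬝ᵥ w₀ = w ⬝ᵥ w - (r ⬝ᵥ w) ^ 2 / (r ⬝ᵥ r) := by
        rw [hw₀, sub_dotProduct, dotProduct_sub, dotProduct_sub, smul_dotProduct, smul_dotProduct,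
          dotProduct_smul, dotProduct_smul, dotProduct_comm w r, hc]
        simp only [smul_eq_mul]
        field_simp
        ring
      have hN0 : 0 < N := by rw [hNdef]; linarith
      rw [← hNdef] at hrr hrw hn
      have hden : 0 < 1 + (N - 1) * (1 - s) := by positivity
      have hden' : 1 - s * (1 - 1 / N) = (1 + (N - 1) * (1 - s)) / N := by
        field_simp
        ring
      rw [e, hww, hrw, hrr, mul_pow, Real.sq_sqrt hn.le, Real.sq_sqrt hs.le, hden']
      field_simp
      ring
    rw [← hw₀w₀]
    linarith
  · rw [Wmat_mulVec_edgeLift h0 h1, ← hg, edgeLift_sub]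
    abel
  · rw [Matrix.mulVec_sub, Wmat_mulVec_edgeLift h0 h1, Wmat_mulVec_swapVecC_edgeLift h0,
      Wmat_mulVec_edgeLift h0 h1, ← hg, edgeLift_sub]
    ext p
    simp only [swapVecC, Pi.sub_apply, Pi.add_apply, Pi.smul_apply, smul_eq_mul]
    ring

end LQWPaper
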